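/- Let x and y be the unique reduced words of elements of the subregular set C, each of length at least 2, such that the last letter of x equals the first letter of y, and suppose that the (two-element) set of letters occurring in the last dihedral segment of x is different from the set of letters occurring in the first dihedral segment of y. Then the glued product x * y is the unique reduced word of an element of C, and the dihedral segments of x * y are precisely the dihedral segments of x followed by the dihedral segments of y. -/

import Mathlib

/-!
Common definitions: alternating words, glued products, dihedral segment
decompositions, unique reduced words, and the subregular set `C`.
-/

/-- The alternating word `(s,t)_l = s t s ⋯` of length `l` beginning with `s`. -/
def altWord {B : Type*} (s t : B) : ℕ → List B
  | 0 => []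
  | k + 1 => s :: altWord t s k

/-- The glued product `x * y` of two words: the concatenation of `x` and `y` with one of the
two adjacent occurrences of the common letter deleted (intended for use when the last letter
of `x` equals the first letter of `y`). -/
def glueWord {B : Type*} (x y : List B) : List B := x ++ y.tail

/-- Iterated glued product `g₁ * g₂ * ⋯ * gₘ`. -/
def glueFold {B : Type*} : List (List B) → List B
  | [] => []
  | g :: rest => rest.foldl glueWord g

/-- `segs` is the list of dihedral segments of the word `x`: the maximal contiguous subwords of
`x` involving (at most) two distinct letters.  Each segment alternates in two distinct letters,
consecutive segments overlap in one letter (so that the glued product of the segments is `x`),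
and maximality is expressed by requiring that consecutive segments have different letter sets. -/
def IsDihedralDecomp {B : Type*} (x : List B) (segs : List (List B)) : Prop :=
  segs ≠ [] ∧
  (∀ seg ∈ segs, ∃ s t : B, s ≠ t ∧ seg ≠ [] ∧ seg = altWord s t seg.length) ∧
  (2 ≤ segs.length → ∀ seg ∈ segs, 2 ≤ seg.length) ∧
  segs.Chain' (fun u v => u.getLast? = v.head? ∧ ({a | a ∈ u} : Set B) ≠ {a | a ∈ v}) ∧
  x = glueFold segs

variable {B : Type*} {W : Type*} [Group W]

/-- `ω` is the unique reduced word of `w`. -/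
def IsUniqueReducedWord {M : CoxeterMatrix B} (cs : CoxeterSystem M W)
    (w : W) (ω : List B) : Prop :=
  cs.wordProd ω = w ∧ cs.IsReduced ω ∧
    ∀ ω' : List B, cs.wordProd ω' = w → cs.IsReduced ω' → ω' = ω

/-- The subregular set `C`: the non-identity elements of `W` admitting exactly one
reduced word. -/
def subregularSet {M : CoxeterMatrix B} (cs : CoxeterSystem M W) : Set W :=
  {w | w ≠ 1 ∧ ∃ ω : List B, IsUniqueReducedWord cs w ω}

/-- `Γ_s ∩ Γ_s⁻¹`: the elements of the subregular set whose unique reduced word both starts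
and ends with `s`. -/
def gammaSet {M : CoxeterMatrix B} (cs : CoxeterSystem M W) (s : B) : Set W :=
  {w | w ≠ 1 ∧ ∃ ω : List B, IsUniqueReducedWord cs w ω ∧
    ω.head? = some s ∧ ω.getLast? = some s}

namespace CoxeterSystem

variable {M : CoxeterMatrix B} (cs : CoxeterSystem M W)

open Classical in
/-- The action of a simple reflection on `W × ZMod 2` whose second coordinate records the parity
of the number of occurrences of an element in an inversion sequence. -/
noncomputable def parityPerm (i : B) : Equiv.Perm (W × ZMod 2) :=
  Function.Involutive.toPerm
    (fun p => (cs.simple i * p.1 * cs.simple i, p.2 + if p.1 = cs.simple i then 1 else 0)) (by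
      rintro ⟨t, e⟩
      have h : cs.simple i * t * cs.simple i = cs.simple i ↔ t = cs.simple i := by
        rw [mul_eq_right, mul_eq_one_iff_eq_inv', cs.inv_simple]
      simp only [h, Prod.mk.injEq]
      constructor
      · simp [mul_assoc]
      · split_ifs
        · rw [add_assoc, CharTwo.add_self_eq_zero, add_zero]
        · simp)

open Classical in
theorem parityPerm_apply (i : B) (t : W) (e : ZMod 2) :
    cs.parityPerm i (t, e) =
      (cs.simple i * t * cs.simple i, e + if t = cs.simple i then 1 else 0) := rfl

open Classical in
theorem parityPerm_mul_pow_apply (i i' : B) (m : ℕ) (t : W) (e : ZMod 2) :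
    ((cs.parityPerm i * cs.parityPerm i') ^ m) (t, e) =
      ((cs.simple i * cs.simple i') ^ m * t * ((cs.simple i * cs.simple i') ^ m)⁻¹,
        e + ∑ k ∈ Finset.range (2 * m),
          if t = cs.simple i' * (cs.simple i * cs.simple i') ^ k then 1 else 0) := by
  induction m with
  | zero => simp
  | succ m ih =>
    set c := cs.simple i * cs.simple i' with hc
    have hrc : cs.simple i' * c = c⁻¹ * cs.simple i' := by simp [hc, mul_assoc]
    have hrck : ∀ k : ℕ, cs.simple i' * c ^ k = (c ^ k)⁻¹ * cs.simple i' := by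
      intro k
      rw [← inv_pow]
      exact (SemiconjBy.pow_right (show SemiconjBy (cs.simple i') c c⁻¹ from hrc) k)
    have h1 : c ^ m * t * (c ^ m)⁻¹ = cs.simple i' ↔ t = cs.simple i' * c ^ (2 * m) := by
      rw [two_mul, pow_add, ← mul_assoc, hrck, mul_inv_eq_iff_eq_mul, ← eq_inv_mul_iff_mul_eq,
        mul_assoc]
    have h2 : cs.simple i' * (c ^ m * t * (c ^ m)⁻¹) * cs.simple i' = cs.simple i ↔
        t = cs.simple i' * c ^ (2 * m + 1) := by
      have : cs.simple i' * c ^ (2 * m + 1) = (c ^ m)⁻¹ * (cs.simple i' * c) * c ^ m := by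
        rw [show 2 * m + 1 = m + 1 + m by ring, pow_add, pow_add, pow_one, ← mul_assoc,
          ← mul_assoc, hrck]
        simp only [mul_assoc]
      rw [this]
      constructor
      · intro h
        have : cs.simple i' * c = c ^ m * t * (c ^ m)⁻¹ := by
          have hX : c ^ m * t * (c ^ m)⁻¹ = cs.simple i' * cs.simple i * cs.simple i' := by
            rw [← h]; simp [mul_assoc]
          rw [hX, hc, ← mul_assoc]
        rw [this]; group
      · intro h
        rw [h]
        have : c ^ m * ((c ^ m)⁻¹ * (cs.simple i' * c) * c ^ m) * (c ^ m)⁻¹ = cs.simple i' * c := by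
          group
        rw [this, hc]; simp [mul_assoc]
    rw [pow_succ', Equiv.Perm.mul_apply, ih, Equiv.Perm.mul_apply, parityPerm_apply,
      parityPerm_apply, Prod.mk.injEq]
    constructor
    · rw [pow_succ']
      simp [hc, mul_assoc]
    · rw [show 2 * (m + 1) = 2 * m + 1 + 1 by ring, Finset.sum_range_succ, Finset.sum_range_succ]
      simp only [h1, h2, add_assoc]

theorem isLiftable_parityPerm : M.IsLiftable cs.parityPerm := by
  classical
  intro i i'
  ext1 ⟨t, e⟩
  rw [parityPerm_mul_pow_apply, two_mul, Finset.sum_range_add]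
  simp only [pow_add, cs.simple_mul_simple_pow, one_mul, CharTwo.add_self_eq_zero]
  simp

open Classical in
theorem lift_parityPerm_wordProd (ω : List B) (t : W) (e : ZMod 2) :
    cs.lift ⟨cs.parityPerm, cs.isLiftable_parityPerm⟩ (cs.wordProd ω) (t, e) =
      (cs.wordProd ω * t * (cs.wordProd ω)⁻¹, e + ((cs.rightInvSeq ω).count t : ZMod 2)) := by
  induction ω with
  | nil => simp
  | cons i ω ih =>
    have h : cs.wordProd ω * t * (cs.wordProd ω)⁻¹ = cs.simple i ↔
        (cs.wordProd ω)⁻¹ * cs.simple i * cs.wordProd ω = t := by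
      rw [mul_inv_eq_iff_eq_mul, ← eq_inv_mul_iff_mul_eq, mul_assoc, eq_comm]
    rw [wordProd_cons, map_mul, Equiv.Perm.mul_apply, ih, lift_apply_simple, parityPerm_apply,
      Prod.mk.injEq]
    constructor
    · simp [mul_assoc]
    · simp only [rightInvSeq, List.count_cons, h, beq_iff_eq]
      push_cast
      rw [add_assoc]

open Classical in
theorem count_leftInvSeq_eq_of_wordProd_eq {ω ω' : List B} (h : cs.wordProd ω = cs.wordProd ω')
    (t : W) :
    ((cs.leftInvSeq ω).count t : ZMod 2) = ((cs.leftInvSeq ω').count t : ZMod 2) := by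
  have key : ∀ ω : List B, (cs.leftInvSeq ω).count t = (cs.rightInvSeq ω.reverse).count t := by
    intro ω
    rw [rightInvSeq_reverse, List.count_reverse]
  have h' : cs.wordProd ω.reverse = cs.wordProd ω'.reverse := by
    rw [wordProd_reverse, wordProd_reverse, h]
  have h1 := cs.lift_parityPerm_wordProd ω.reverse t 0
  rw [h', lift_parityPerm_wordProd, Prod.mk.injEq, zero_add, zero_add] at h1
  rw [key, key, h1.2]

/-- The exchange property. -/
theorem IsReduced.exists_wordProd_eraseIdx {cs : CoxeterSystem M W} {ω : List B}
    (hω : cs.IsReduced ω) {i : B} (hi : cs.IsLeftDescent (cs.wordProd ω) i) :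
    ∃ j < ω.length, (cs.leftInvSeq ω).getD j 1 = cs.simple i ∧
      cs.IsReduced (i :: ω.eraseIdx j) ∧ cs.wordProd (i :: ω.eraseIdx j) = cs.wordProd ω := by
  classical
  obtain ⟨υ, hυ, hυw⟩ := cs.exists_isReduced (cs.simple i * cs.wordProd ω)
  have hprod : cs.wordProd (i :: υ) = cs.wordProd ω := by
    rw [wordProd_cons, ← hυw, simple_mul_simple_cancel_left]
  have hred : cs.IsReduced (i :: υ) := by
    have := cs.isLeftDescent_iff.1 hi
    rw [IsReduced, hprod, List.length_cons, ← hυ.eq, ← hυw, this]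
  have hcount : (cs.leftInvSeq (i :: υ)).count (cs.simple i) = 1 :=
    List.count_eq_one_of_mem hred.nodup_leftInvSeq (by simp [leftInvSeq])
  have hmem : cs.simple i ∈ cs.leftInvSeq ω := by
    by_contra hn
    have := cs.count_leftInvSeq_eq_of_wordProd_eq hprod (cs.simple i)
    rw [hcount, List.count_eq_zero_of_not_mem hn] at this
    simp at this
  obtain ⟨j, hj, hjt⟩ := List.getElem_of_mem hmem
  have hj' : j < ω.length := by simpa using hj
  have hgetD : (cs.leftInvSeq ω).getD j 1 = cs.simple i := by
    rw [List.getD_eq_getElem _ _ hj, hjt]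
  have hp : cs.wordProd (i :: ω.eraseIdx j) = cs.wordProd ω := by
    rw [wordProd_cons, ← getD_leftInvSeq_mul_wordProd, hgetD, simple_mul_simple_cancel_left]
  refine ⟨j, hj', hgetD, ?_, hp⟩
  rw [IsReduced, hp, hω.eq, List.length_cons, List.length_eraseIdx_add_one hj']

end CoxeterSystem

@[simp]
theorem length_altWord (s t : B) (k : ℕ) : (altWord s t k).length = k := by
  induction k generalizing s t with
  | zero => rfl
  | succ k ih => simp [altWord, ih]

theorem altWord_add (s t : B) (m n : ℕ) : ∃ v, altWord s t (m + n) = altWord s t m ++ v := by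
  induction m generalizing s t with
  | zero => exact ⟨_, rfl⟩
  | succ m ih =>
    obtain ⟨v, hv⟩ := ih t s
    exact ⟨v, by rw [Nat.add_right_comm, altWord, hv]; rfl⟩

theorem eq_of_altWord_eq_append {s t : B} {k : ℕ} {p q : List B} {a c b : B}
    (h : altWord s t k = p ++ a :: c :: b :: q) : a = b := by
  induction k generalizing s t p with
  | zero => simp [altWord] at h
  | succ k ih =>
    cases p with
    | cons d p =>
      simp only [altWord, List.cons_append, List.cons.injEq] at h
      exact ih h.2
    | nil =>
      rcases k with _ | _ | k
      · simp [altWord] at h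
      · simp [altWord] at h
      · simp only [altWord, List.nil_append, List.cons.injEq] at h
        rw [← h.1, ← h.2.2.1]

namespace CoxeterSystem

variable {M : CoxeterMatrix B} (cs : CoxeterSystem M W)

theorem wordProd_altWord (s t : B) (k : ℕ) :
    cs.wordProd (altWord s t k) =
      (cs.simple s * cs.simple t) ^ k * cs.wordProd (altWord t s k) := by
  induction k generalizing s t with
  | zero => simp [altWord]
  | succ k ih =>
    have h : cs.simple s * (cs.simple t * cs.simple s) ^ k =
        (cs.simple s * cs.simple t) ^ k * cs.simple s :=
      SemiconjBy.pow_right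
        (show SemiconjBy (cs.simple s) (cs.simple t * cs.simple s) (cs.simple s * cs.simple t) from
          (mul_assoc _ _ _).symm) k
    rw [altWord, altWord, wordProd_cons, wordProd_cons, ih, ← mul_assoc, h, pow_succ]
    simp [mul_assoc]

theorem getD_leftInvSeq_altWord_append (s t : B) (k : ℕ) (v : List B) {j : ℕ} (hj : j < k) :
    (cs.leftInvSeq (altWord s t k ++ v)).getD j 1 =
      (cs.simple s * cs.simple t) ^ j * cs.simple s := by
  induction k generalizing s t j with
  | zero => omega
  | succ k ih =>
    cases j with
    | zero => simp [altWord, leftInvSeq]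
    | succ j =>
      have h := ih t s (j := j) (by omega)
      have hlt : j < (cs.leftInvSeq (altWord t s k ++ v)).length := by
        simp; omega
      have hs : cs.simple s * (cs.simple t * cs.simple s) ^ j =
          (cs.simple s * cs.simple t) ^ j * cs.simple s :=
        SemiconjBy.pow_right (show SemiconjBy (cs.simple s) (cs.simple t * cs.simple s)
          (cs.simple s * cs.simple t) from (mul_assoc _ _ _).symm) j
      rw [List.getD_eq_getElem _ _ hlt] at h
      have hlt' : j + 1 < (cs.leftInvSeq (altWord s t (k + 1) ++ v)).length := by
        simp; omega
      rw [List.getD_eq_getElem _ _ hlt']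
      simp only [altWord, List.cons_append, leftInvSeq, List.getElem_cons_succ, List.getElem_map, h,
        MulAut.conj_apply, inv_simple]
      rw [← mul_assoc, hs, pow_succ]
      simp [mul_assoc]

/-- If `s` and `t` are left descents of `w`, then a braid relation in `s` and `t` applies
to the beginning of some reduced word of `w`. -/
theorem exists_isReduced_altWord_append {w : W} {s t : B} (hs : cs.IsLeftDescent w s)
    (ht : cs.IsLeftDescent w t) :
    ∃ m v, 1 ≤ m ∧ (cs.simple s * cs.simple t) ^ m = 1 ∧ cs.IsReduced (altWord s t m ++ v) ∧
      cs.wordProd (altWord s t m ++ v) = w := by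
  have step : ∀ {a b : B} {k : ℕ} {v : List B}, cs.IsLeftDescent w b →
      cs.IsReduced (altWord a b k ++ v) → cs.wordProd (altWord a b k ++ v) = w →
      (∃ m v, 1 ≤ m ∧ (cs.simple a * cs.simple b) ^ m = 1 ∧ cs.IsReduced (altWord a b m ++ v) ∧
        cs.wordProd (altWord a b m ++ v) = w) ∨
      ∃ v, cs.IsReduced (altWord b a (k + 1) ++ v) ∧
        cs.wordProd (altWord b a (k + 1) ++ v) = w := by
    intro a b k v hb hred hw
    obtain ⟨j, -, hget, hred', hw'⟩ := hred.exists_wordProd_eraseIdx (hw.symm ▸ hb)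
    rcases lt_or_ge j k with hj | hj
    · left
      obtain ⟨u, hu⟩ := altWord_add a b (j + 1) (k - (j + 1))
      rw [show j + 1 + (k - (j + 1)) = k by omega] at hu
      rw [getD_leftInvSeq_altWord_append _ _ _ _ _ hj] at hget
      refine ⟨j + 1, u ++ v, by omega, ?_, ?_, ?_⟩
      · rw [pow_succ, ← mul_assoc, hget, simple_mul_simple_self]
      · rwa [← List.append_assoc, ← hu]
      · rwa [← List.append_assoc, ← hu]
    · right
      refine ⟨v.eraseIdx (j - k), ?_⟩
      rw [List.eraseIdx_append_of_length_le (by simpa using hj), length_altWord] at hred' hw'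
      exact ⟨hred', hw'.trans hw⟩
  by_contra hno
  have main : ∀ k, ∃ v, (cs.IsReduced (altWord s t k ++ v) ∧
      cs.wordProd (altWord s t k ++ v) = w) ∨
      (cs.IsReduced (altWord t s k ++ v) ∧ cs.wordProd (altWord t s k ++ v) = w) := by
    intro k
    induction k with
    | zero =>
      obtain ⟨v, hv, hw⟩ := cs.exists_isReduced w
      exact ⟨v, .inl ⟨hv, hw.symm⟩⟩
    | succ k ih =>
      obtain ⟨v, ⟨hv, hw⟩ | ⟨hv, hw⟩⟩ := ih
      · obtain h | ⟨u, hu⟩ := step ht hv hw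
        · exact absurd h hno
        · exact ⟨u, .inr hu⟩
      · obtain ⟨m, u, hm, hpow, hu, huw⟩ | ⟨u, hu⟩ := step hs hv hw
        · have hpow' : (cs.simple s * cs.simple t) ^ m = 1 := by
            rw [← inv_inj, ← inv_pow, mul_inv_rev, inv_simple, inv_simple, hpow, inv_one]
          have hprod : cs.wordProd (altWord s t m ++ u) = w := by
            rw [← huw, wordProd_append, wordProd_append, wordProd_altWord, hpow', one_mul]
          refine absurd ⟨m, u, hm, hpow', ?_, hprod⟩ hno
          rw [IsReduced, hprod, ← huw, hu.eq]
          simp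
        · exact ⟨u, .inl hu⟩
  obtain ⟨v, ⟨hv, hw⟩ | ⟨hv, hw⟩⟩ := main (cs.length w + 1) <;>
  · have := hv.eq
    rw [hw, List.length_append, length_altWord] at this
    omega

/-- A word is rigid if it has no factor `s s` and no braid relation applies to it. -/
structure IsRigid (x : List B) : Prop where
  not_isInfix_pair : ∀ s, ¬ [s, s] <:+: x
  not_isInfix_altWord : ∀ s t m, s ≠ t → 1 ≤ m → (cs.simple s * cs.simple t) ^ m = 1 →
    ¬ altWord s t m <:+: x

variable {cs}

theorem IsRigid.of_isInfix {x y : List B} (hy : cs.IsRigid y) (h : x <:+: y) : cs.IsRigid x :=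
  ⟨fun s hs => hy.1 s (hs.trans h), fun s t m hst hm hp hx => hy.2 s t m hst hm hp (hx.trans h)⟩

theorem IsRigid.isUniqueReducedWord {x : List B} (hx : cs.IsRigid x) :
    IsUniqueReducedWord cs (cs.wordProd x) x := by
  induction x with
  | nil =>
    refine ⟨rfl, by simp [IsReduced], fun u hu hr => ?_⟩
    have := hr.eq
    rw [hu, wordProd_nil, length_one] at this
    exact List.eq_nil_of_length_eq_zero this.symm
  | cons s z ih =>
    obtain ⟨-, hz, huniq⟩ := ih (hx.of_isInfix (List.suffix_cons s z).isInfix)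
    have hnd : ¬ cs.IsLeftDescent (cs.wordProd z) s := by
      intro hd
      obtain ⟨j, -, -, hr, hp⟩ := hz.exists_wordProd_eraseIdx hd
      have heq := huniq _ hp hr
      apply hx.not_isInfix_pair s
      rw [← heq]
      exact ⟨[], z.eraseIdx j, rfl⟩
    have hred : cs.IsReduced (s :: z) := by
      rw [IsReduced, wordProd_cons, cs.not_isLeftDescent_iff.1 hnd, hz.eq, List.length_cons]
    have htail : ∀ v, cs.wordProd (s :: v) = cs.wordProd (s :: z) → cs.IsReduced (s :: v) →
        v = z := by
      intro v hv hr
      rw [wordProd_cons, wordProd_cons, mul_right_inj] at hv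
      exact huniq v hv (hr.drop 1)
    have hdesc : ∀ r v, cs.wordProd (r :: v) = cs.wordProd (s :: z) → cs.IsReduced (r :: v) →
        cs.IsLeftDescent (cs.wordProd (s :: z)) r := by
      intro r v hv hr
      have hv' : cs.IsReduced v := hr.drop 1
      rw [← hv, IsLeftDescent, hr.eq, wordProd_cons, simple_mul_simple_cancel_left, hv'.eq]
      simp
    refine ⟨rfl, hred, fun u hu hr => ?_⟩
    cases u with
    | nil =>
      have := hred.eq
      rw [← hu] at this
      simp at this
    | cons r v =>
      by_cases hrs : r = s
      · subst hrs
        rw [htail v hu hr]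
      · obtain ⟨m, q, hm, hpow, hq, hqw⟩ :=
          cs.exists_isReduced_altWord_append (hdesc s z rfl hred) (hdesc r v hu hr)
        obtain ⟨m, rfl⟩ := Nat.exists_eq_add_of_le' hm
        refine absurd ?_ (hx.not_isInfix_altWord s r (m + 1) (Ne.symm hrs) hm hpow)
        exact ⟨[], q, congrArg (s :: ·) (htail _ hqw hq)⟩

theorem isRigid_of_isUniqueReducedWord {w : W} {x : List B} (hx : IsUniqueReducedWord cs w x) :
    cs.IsRigid x := by
  obtain ⟨rfl, hred, huniq⟩ := hx
  constructor
  · rintro s ⟨p, q, rfl⟩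
    have h : cs.wordProd (p ++ [s, s] ++ q) = cs.wordProd (p ++ q) := by
      simp [wordProd_append, wordProd_cons]
    have hle := cs.length_wordProd_le (p ++ q)
    rw [← h, hred.eq] at hle
    simp at hle
  · rintro s t m hst hm hpow ⟨p, q, rfl⟩
    have h : cs.wordProd (p ++ altWord t s m ++ q) = cs.wordProd (p ++ altWord s t m ++ q) := by
      simp only [wordProd_append, cs.wordProd_altWord s t, hpow, one_mul]
    have heq := huniq _ h (by rw [IsReduced, h, hred.eq]; simp)
    obtain ⟨m, rfl⟩ := Nat.exists_eq_add_of_le' hm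
    simp only [List.append_assoc, List.append_cancel_left_eq, altWord, List.cons_append,
      List.cons.injEq] at heq
    exact hst heq.1.symm

end CoxeterSystem

theorem List.IsInfix.of_append_triple {v X Y : List B} {a t b : B}
    (h : v <:+: (X ++ [a, t]) ++ b :: Y) :
    [a, t, b] <:+: v ∨ v <:+: X ++ [a, t] ∨ v <:+: t :: b :: Y := by
  rcases List.infix_append_iff.1 h with h | h | ⟨l, r, rfl, hl, hr⟩
  · exact .inr (.inl h)
  · exact .inr (.inr (h.trans (List.suffix_cons t _).isInfix))
  · cases r with
    | nil => exact .inr (.inl (by simpa using hl.isInfix))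
    | cons c r =>
      obtain ⟨rfl, hr'⟩ := List.cons_prefix_cons.1 hr
      rcases l.eq_nil_or_concat' with rfl | ⟨l, d, rfl⟩
      · exact .inr (.inr (hr.isInfix.trans (List.suffix_cons t _).isInfix))
      · rw [show X ++ [a, t] = (X ++ [a]) ++ [t] by simp] at hl
        obtain ⟨p, hp⟩ := hl
        rw [← List.append_assoc] at hp
        obtain ⟨hpl, hd⟩ := List.append_inj' hp rfl
        obtain rfl : d = t := by simpa using hd
        rcases l.eq_nil_or_concat' with rfl | ⟨l, e, rfl⟩
        · right; right
          exact (List.cons_prefix_cons.2 ⟨rfl, hr⟩).isInfix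
        · rw [← List.append_assoc] at hpl
          obtain rfl : e = a := by
            simpa using (List.append_inj' (t₁ := [e]) (t₂ := [a]) hpl rfl).2
          exact .inl ⟨l, r, by simp⟩

theorem CoxeterSystem.IsRigid.append_of_ne {M : CoxeterMatrix B} {cs : CoxeterSystem M W}
    {X Y : List B} {a t b : B} (hx : cs.IsRigid (X ++ [a, t])) (hy : cs.IsRigid (t :: b :: Y))
    (hab : a ≠ b) : cs.IsRigid ((X ++ [a, t]) ++ b :: Y) := by
  constructor
  · intro s h
    rcases h.of_append_triple with h | h | h
    · simpa using h.length_le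
    · exact hx.not_isInfix_pair s h
    · exact hy.not_isInfix_pair s h
  · intro s r m hsr hm hpow h
    rcases h.of_append_triple with ⟨p, q, h⟩ | h | h
    · exact hab (eq_of_altWord_eq_append (p := p) (c := t) (q := q) (by rw [← h]; simp))
    · exact hx.not_isInfix_altWord s r m hsr hm hpow h
    · exact hy.not_isInfix_altWord s r m hsr hm hpow h

theorem mem_altWord {s t a : B} {k : ℕ} (h : a ∈ altWord s t k) : a = s ∨ a = t := by
  induction k generalizing s t with
  | zero => simp [altWord] at h
  | succ k ih =>
    rcases List.mem_cons.1 h with h | h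
    · exact .inl h
    · exact (ih h).symm

theorem setOf_mem_altWord {s t a b : B} {k : ℕ} (ha : a ∈ altWord s t k)
    (hb : b ∈ altWord s t k) (hab : a ≠ b) : ({c | c ∈ altWord s t k} : Set B) = {a, b} := by
  ext c
  simp only [Set.mem_ofPred_eq, Set.mem_insert_iff, Set.mem_singleton_iff]
  refine ⟨fun hc => ?_, ?_⟩
  · rcases mem_altWord ha with rfl | rfl <;> rcases mem_altWord hb with rfl | rfl <;>
      rcases mem_altWord hc with rfl | rfl <;> simp_all
  · rintro (rfl | rfl) <;> assumption

theorem glueFold_append_singleton {l : List (List B)} (hl : l ≠ []) (u : List B) :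
    glueFold (l ++ [u]) = glueWord (glueFold l) u := by
  cases l with
  | nil => exact absurd rfl hl
  | cons g l => simp [glueFold]

theorem prefix_glueFold (g : List B) (l : List (List B)) : g <+: glueFold (g :: l) := by
  induction l using List.reverseRecOn with
  | nil => exact List.prefix_rfl
  | append_singleton l u ih =>
    rw [← List.cons_append, glueFold_append_singleton (by simp)]
    exact ih.trans (List.prefix_append _ _)

theorem glueFold_append {l l' : List (List B)} (hl : l ≠ []) (hl' : l' ≠ [])
    (hne : ∀ u ∈ l', u ≠ []) :
    glueFold (l ++ l') = glueWord (glueFold l) (glueFold l') := by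
  induction l' using List.reverseRecOn with
  | nil => exact absurd rfl hl'
  | append_singleton l' u ih =>
    rcases l' with _ | ⟨g, l'⟩
    · exact glueFold_append_singleton hl u
    · have hg : glueFold (g :: l') ≠ [] := fun h =>
        hne g (by simp) (List.prefix_nil.1 (h ▸ prefix_glueFold g l'))
      rw [← List.append_assoc, glueFold_append_singleton (by simp),
        glueFold_append_singleton (by simp),
        ih (by simp) fun v hv => hne v (List.mem_append_left _ hv)]
      simp only [glueWord, List.append_assoc]
      rw [List.tail_append_of_ne_nil hg]

theorem List.IsSuffix.getLast?_eq {u x : List B} (h : u <:+ x) (hu : u ≠ []) :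
    x.getLast? = u.getLast? := by
  obtain ⟨p, rfl⟩ := h
  exact List.getLast?_append_of_ne_nil p hu

theorem suffix_glueFold {l : List (List B)} {u : List B} (hne : ∀ v ∈ l ++ [u], v ≠ [])
    (hc : (l ++ [u]).IsChain fun v w => v.getLast? = w.head?) :
    u <:+ glueFold (l ++ [u]) := by
  induction l using List.reverseRecOn generalizing u with
  | nil => exact List.suffix_rfl
  | append_singleton l v ih =>
    rw [glueFold_append_singleton (by simp)]
    obtain ⟨hc', -, h⟩ := List.isChain_append.1 hc
    have hv := ih (fun w hw => hne w (List.mem_append_left _ hw)) hc'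
    have h1 : v.getLast? = u.head? := h v (by simp) u (by simp)
    rw [← hv.getLast?_eq (hne v (by simp))] at h1
    cases u with
    | nil => exact absurd rfl (hne [] (by simp))
    | cons t u =>
      obtain ⟨z, hz⟩ := List.getLast?_eq_some_iff.1 h1
      rw [hz]
      exact ⟨z, by simp [glueWord]⟩

namespace IsDihedralDecomp

theorem two_le_length {x : List B} {segs : List (List B)} (h : IsDihedralDecomp x segs)
    (hx : 2 ≤ x.length) : ∀ u ∈ segs, 2 ≤ u.length := by
  obtain ⟨hne, -, hlen, -, rfl⟩ := h
  rcases segs with _ | ⟨u, _ | ⟨v, l⟩⟩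
  · exact absurd rfl hne
  · simpa [glueFold] using hx
  · exact hlen (by simp)

theorem exists_head_isPrefix {x : List B} {segs : List (List B)} (h : IsDihedralDecomp x segs) :
    ∃ u, segs.head? = some u ∧ u <+: x := by
  obtain ⟨hne, -, -, -, rfl⟩ := h
  rcases segs with _ | ⟨u, l⟩
  · exact absurd rfl hne
  · exact ⟨u, rfl, prefix_glueFold u l⟩

theorem exists_getLast_isSuffix {x : List B} {segs : List (List B)} (h : IsDihedralDecomp x segs) :
    ∃ u, segs.getLast? = some u ∧ u <:+ x := by
  obtain ⟨hne, halt, -, hc, rfl⟩ := h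
  rcases segs.eq_nil_or_concat' with rfl | ⟨l, u, rfl⟩
  · exact absurd rfl hne
  · refine ⟨u, by simp, suffix_glueFold (fun v hv => ?_) (hc.imp fun _ _ h => h.1)⟩
    obtain ⟨_, _, _, h, _⟩ := halt v hv
    exact h

end IsDihedralDecomp

/-- If `x` and `y` are unique reduced words of elements of the subregular set `C`, each of
length at least `2`, the last letter of `x` equals the first letter of `y`, and the letter set
of the last dihedral segment of `x` differs from the letter set of the first dihedral segment
of `y`, then the glued product `x * y` is the unique reduced word of an element of `C`, and
its dihedral segments are those of `x` followed by those of `y`. -/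
theorem glued_product_subregular {M : CoxeterMatrix B} (cs : CoxeterSystem M W)
    (x y : List B) (hx2 : 2 ≤ x.length) (hy2 : 2 ≤ y.length)
    (hx : ∃ w : W, w ∈ subregularSet cs ∧ IsUniqueReducedWord cs w x)
    (hy : ∃ w : W, w ∈ subregularSet cs ∧ IsUniqueReducedWord cs w y)
    (hglue : x.getLast? = y.head?)
    (sx sy : List (List B))
    (hsx : IsDihedralDecomp x sx) (hsy : IsDihedralDecomp y sy)
    (hsets : ∀ u v : List B, sx.getLast? = some u → sy.head? = some v →
      ({a | a ∈ u} : Set B) ≠ {a | a ∈ v}) :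
    (∃ w : W, w ∈ subregularSet cs ∧ IsUniqueReducedWord cs w (glueWord x y)) ∧
    IsDihedralDecomp (glueWord x y) (sx ++ sy) := by
  obtain ⟨u, hu, hux⟩ := hsx.exists_getLast_isSuffix
  obtain ⟨v, hv, hvy⟩ := hsy.exists_head_isPrefix
  have hus := List.mem_of_getLast? hu
  have hvs := List.mem_of_head? hv
  have hu2 := hsx.two_le_length hx2 u hus
  have hv2 := hsy.two_le_length hy2 v hvs
  have huv := hsets u v hu hv
  have hxlast := hux.getLast?_eq (List.ne_nil_of_length_pos (by omega))
  constructor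
  · obtain ⟨_, -, hx⟩ := hx
    obtain ⟨_, -, hy⟩ := hy
    replace hx := CoxeterSystem.isRigid_of_isUniqueReducedWord hx
    replace hy := CoxeterSystem.isRigid_of_isUniqueReducedWord hy
    obtain ⟨c, d, -, -, hualt⟩ := hsx.2.1 u hus
    obtain ⟨c', d', -, -, hvalt⟩ := hsy.2.1 v hvs
    obtain ⟨U, a, t, rfl⟩ : ∃ U a t, u = U ++ [a, t] := by
      obtain ⟨r, hr⟩ : ∃ r, u.reverse = r := ⟨_, rfl⟩
      rcases r with _ | ⟨t, _ | ⟨a, r⟩⟩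
      · simp [List.reverse_eq_iff.1 hr] at hu2
      · simp [List.reverse_eq_iff.1 hr] at hu2
      · exact ⟨r.reverse, a, t, by rw [List.reverse_eq_iff.1 hr]; simp⟩
    obtain ⟨p, rfl⟩ := hux
    obtain ⟨q, rfl⟩ := hvy
    rcases v with _ | ⟨t', _ | ⟨b, V⟩⟩
    · simp at hv2
    · simp at hv2
    obtain rfl : t = t' := by simpa using hglue
    have hat : a ≠ t := by
      rintro rfl
      exact hx.not_isInfix_pair a ⟨p ++ U, [], by simp⟩
    have htb : t ≠ b := by
      rintro rfl
      exact hy.not_isInfix_pair t ⟨[], V ++ q, by simp⟩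
    have hab : a ≠ b := by
      rintro rfl
      apply huv
      rw [hualt, hvalt, setOf_mem_altWord (a := a) (b := t) (hualt ▸ by simp) (hualt ▸ by simp) hat,
        setOf_mem_altWord (a := a) (b := t) (hvalt ▸ by simp) (hvalt ▸ by simp) hat]
    rw [← List.append_assoc] at hx
    have hz := (hx.append_of_ne hy hab).isUniqueReducedWord
    have hglued : glueWord (p ++ (U ++ [a, t])) (t :: b :: V ++ q) =
        (p ++ U ++ [a, t]) ++ b :: (V ++ q) := by
      simp [glueWord]
    rw [hglued]
    refine ⟨_, ⟨fun h1 => ?_, _, hz⟩, hz⟩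
    have hlen := hz.2.1.eq
    rw [h1, CoxeterSystem.length_one] at hlen
    simp at hlen
  · have hsy_ne : ∀ w ∈ sy, w ≠ [] := fun w hw =>
      List.ne_nil_of_length_pos (by have := hsy.two_le_length hy2 w hw; omega)
    refine ⟨by simp [hsx.1], ?_, fun _ => ?_, ?_, ?_⟩
    · intro w hw
      exact (List.mem_append.1 hw).elim (hsx.2.1 w) (hsy.2.1 w)
    · intro w hw
      exact (List.mem_append.1 hw).elim (hsx.two_le_length hx2 w) (hsy.two_le_length hy2 w)
    · refine List.isChain_append.2 ⟨hsx.2.2.2.1, hsy.2.2.2.1, ?_⟩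
      rw [hu, hv]
      rintro _ ⟨⟩ _ ⟨⟩
      refine ⟨?_, huv⟩
      rw [← hxlast, hglue]
      obtain ⟨q, rfl⟩ := hvy
      exact List.head?_append_of_ne_nil _ (hsy_ne v hvs)
    · rw [glueFold_append hsx.1 hsy.1 hsy_ne, ← hsx.2.2.2.2, ← hsy.2.2.2.2]
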